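/- arXiv:1201.5173 — 8 statements merged into one kernel-verified Lean document; each statement's English description precedes it below -/
import Mathlib

section
/- Let τ ∈ ℕ and let G₁, G₂, …, G_q be independent geometric random variables with parameters p₁, p₂, …, p_q satisfying 1 ≥ p₁ ≥ p₂ ≥ … ≥ p_q > 0. Let l be the largest integer ℓ with 0 ≤ ℓ ≤ q such that Σ_{i=1}^{ℓ} 1/p_i ≤ τ. Then Σ_{i=1}^{q} Pr(G₁ + G₂ + ⋯ + G_i ≤ τ) < l + 1. -/
open Finset

/-- `probSumLe p n τ` is the probability that `G₁ + ⋯ + G_n ≤ τ`, where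
`G₁, …, G_n` are independent geometric random variables taking values in
`{1, 2, 3, …}` with `Pr(G_i = k) = p (i-1) * (1 - p (i-1)) ^ (k - 1)`
(i.e. with parameters `p 0, …, p (n-1)`).  It is computed by summing the joint
probability mass over all tuples of values `(k 0, …, k (n-1))`, each in
`{1, …, τ}`, whose total is at most `τ`. -/
noncomputable def probSumLe (p : ℕ → ℝ) (n τ : ℕ) : ℝ :=
  ∑ k ∈ (Fintype.piFinset fun _ : Fin n => Finset.Icc 1 τ).filter
      (fun k => ∑ j, k j ≤ τ),
    ∏ j : Fin n, p j * (1 - p j) ^ (k j - 1)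

theorem probSumLe_eq_sum_of_le (p : ℕ → ℝ) (n : ℕ) {t N : ℕ} (h : t ≤ N) :
    probSumLe p n t = ∑ k ∈ (Fintype.piFinset fun _ : Fin n => Icc 1 N).filter
      (fun k => ∑ j, k j ≤ t), ∏ j : Fin n, p j * (1 - p j) ^ (k j - 1) := by
  unfold probSumLe
  congr 1
  ext k
  simp only [mem_filter, Fintype.mem_piFinset, mem_Icc]
  refine and_congr_left fun hk => forall_congr' fun j => and_congr_right fun _ => ?_
  have hj : k j ≤ ∑ j, k j := single_le_sum (fun _ _ => Nat.zero_le _) (mem_univ j)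
  omega

theorem probSumLe_zero_left (p : ℕ → ℝ) (t : ℕ) : probSumLe p 0 t = 1 := by
  simp [probSumLe]

/-- Conditioning on the value of the last variable. -/
theorem probSumLe_succ_left (p : ℕ → ℝ) (n t : ℕ) :
    probSumLe p (n + 1) t =
      ∑ m ∈ range t, p n * (1 - p n) ^ m * probSumLe p n (t - (m + 1)) := by
  have hN : ∀ m ∈ range t, p n * (1 - p n) ^ m * probSumLe p n (t - (m + 1)) =
      ∑ k ∈ (Fintype.piFinset fun _ : Fin n => Icc 1 t).filter
        (fun k => ∑ j, k j ≤ t - (m + 1)),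
        p n * (1 - p n) ^ m * ∏ j : Fin n, p j * (1 - p j) ^ (k j - 1) := fun m _ => by
    rw [probSumLe_eq_sum_of_le p n (Nat.sub_le t (m + 1)), mul_sum]
  rw [sum_congr rfl hN, sum_sigma', probSumLe]
  refine sum_bij' (fun k _ => ⟨k (Fin.last n) - 1, Fin.init k⟩)
    (fun x _ => Fin.snoc (α := fun _ => ℕ) x.2 (x.1 + 1)) ?_ ?_ ?_ ?_ ?_
  · intro k hk
    simp only [mem_filter, Fintype.mem_piFinset, mem_Icc, Fin.sum_univ_castSucc] at hk
    simp only [mem_sigma, mem_range, mem_filter, Fintype.mem_piFinset, mem_Icc, Fin.init]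
    have := hk.1 (Fin.last n)
    exact ⟨by omega, fun j => hk.1 j.castSucc, by omega⟩
  · rintro ⟨m, k⟩ hx
    simp only [mem_sigma, mem_range, mem_filter, Fintype.mem_piFinset, mem_Icc] at hx
    simp only [mem_filter, Fintype.mem_piFinset, mem_Icc, Fin.sum_univ_castSucc,
      Fin.snoc_castSucc, Fin.snoc_last]
    refine ⟨fun j => ?_, by omega⟩
    induction j using Fin.lastCases with
    | last => simp only [Fin.snoc_last]; omega
    | cast j => simpa only [Fin.snoc_castSucc] using hx.2.1 j
  · intro k hk
    simp only [mem_filter, Fintype.mem_piFinset, mem_Icc] at hk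
    simp only [Nat.sub_add_cancel (hk.1 (Fin.last n)).1, Fin.snoc_init_self]
  · rintro ⟨m, k⟩ _
    simp
  · intro k _
    simp only [Fin.prod_univ_castSucc, Fin.init, Fin.val_castSucc, Fin.val_last]
    ring

theorem probSumLe_succ_zero (p : ℕ → ℝ) (n : ℕ) : probSumLe p (n + 1) 0 = 0 := by
  simp [probSumLe_succ_left]

/-- Conditioning on whether the last variable equals `1`, by memorylessness. -/
theorem probSumLe_succ_succ (p : ℕ → ℝ) (n t : ℕ) :
    probSumLe p (n + 1) (t + 1) =
      p n * probSumLe p n t + (1 - p n) * probSumLe p (n + 1) t := by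
  rw [probSumLe_succ_left p n (t + 1), sum_range_succ', probSumLe_succ_left p n t, mul_sum,
    add_comm]
  congr 1
  · simp
  · refine sum_congr rfl fun m _ => ?_
    rw [Nat.add_sub_add_right]
    ring

theorem probSumLe_mem_Icc (p : ℕ → ℝ) (n t : ℕ) (hp : ∀ i < n, p i ∈ Set.Icc (0 : ℝ) 1) :
    probSumLe p n t ∈ Set.Icc (0 : ℝ) 1 := by
  induction n generalizing t with
  | zero => simp [probSumLe_zero_left]
  | succ n ihn =>
    induction t with
    | zero => simp [probSumLe_succ_zero]
    | succ t iht =>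
      have hn := hp n n.lt_succ_self
      rw [probSumLe_succ_succ]
      exact convex_Icc (0 : ℝ) 1 (ihn t fun i hi => hp i (hi.trans n.lt_succ_self)) iht
        hn.1 (sub_nonneg.2 hn.2) (by ring)

/-- The expected total mean service time of the packets delivered by time `t` is at most `t`. -/
theorem sum_probSumLe_div_le (p : ℕ → ℝ) (q t : ℕ) (hp : ∀ i < q, p i ∈ Set.Ioc (0 : ℝ) 1) :
    ∑ i ∈ range q, probSumLe p (i + 1) t / p i ≤ t := by
  induction t with
  | zero => simp [probSumLe_succ_zero]
  | succ t ih =>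
    have step : ∀ i ∈ range q, probSumLe p (i + 1) (t + 1) / p i =
        probSumLe p (i + 1) t / p i + (probSumLe p i t - probSumLe p (i + 1) t) := by
      intro i hi
      have := (hp i (mem_range.1 hi)).1.ne'
      rw [probSumLe_succ_succ]
      field_simp
      ring
    have hq := (probSumLe_mem_Icc p q t fun i hi => Set.Ioc_subset_Icc_self (hp i hi)).1
    rw [sum_congr rfl step, sum_add_distrib, sum_range_sub', probSumLe_zero_left]
    push_cast
    linarith

/-- if `1 ≥ p₁ ≥ ⋯ ≥ p_q > 0` and `l` is the largest `ℓ ≤ q` with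
`Σ_{i=1}^{ℓ} 1/p_i ≤ τ`, then `Σ_{i=1}^{q} Pr(G₁ + ⋯ + G_i ≤ τ) < l + 1`. -/
theorem stmt0 (τ q : ℕ) (p : ℕ → ℝ)
    (hp_le : ∀ i < q, p i ≤ 1) (hp_pos : ∀ i < q, 0 < p i)
    (hmono : ∀ i, i + 1 < q → p (i + 1) ≤ p i)
    (l : ℕ) (hlq : l ≤ q)
    (hl : ∑ i ∈ Finset.range l, 1 / p i ≤ (τ : ℝ))
    (hlmax : ∀ m ≤ q, ∑ i ∈ Finset.range m, 1 / p i ≤ (τ : ℝ) → m ≤ l) :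
    ∑ i ∈ Finset.range q, probSumLe p (i + 1) τ < (l : ℝ) + 1 := by
  have hp : ∀ i < q, p i ∈ Set.Ioc (0 : ℝ) 1 := fun i hi => ⟨hp_pos i hi, hp_le i hi⟩
  have hprob : ∀ i < q, probSumLe p (i + 1) τ ∈ Set.Icc (0 : ℝ) 1 := fun i hi =>
    probSumLe_mem_Icc p (i + 1) τ fun j hj =>
      Set.Ioc_subset_Icc_self (hp j (by omega))
  rcases hlq.eq_or_lt with rfl | hlq
  · have h := sum_le_card_nsmul (range l) (fun i => probSumLe p (i + 1) τ) 1
      fun i hi => (hprob i (mem_range.1 hi)).2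
    simp only [card_range, nsmul_eq_mul, mul_one] at h
    linarith
  · have hanti : ∀ i j, i ≤ j → j < q → p j ≤ p i := fun i j hij => by
      induction j, hij using Nat.le_induction with
      | base => exact fun _ => le_rfl
      | succ j _ ih => exact fun hj => (hmono j hj).trans (ih (by omega))
    have hgt : (τ : ℝ) < ∑ i ∈ range (l + 1), 1 / p i := by
      by_contra! h
      exact absurd (hlmax (l + 1) hlq h) (by omega)
    have hpl := hp_pos l hlq
    have hsub : range (l + 1) ⊆ range q := range_subset_range.2 hlq
    have hhead : ∑ i ∈ range (l + 1), (probSumLe p (i + 1) τ - 1) / p l ≤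
        ∑ i ∈ range (l + 1), (probSumLe p (i + 1) τ - 1) / p i := by
      refine sum_le_sum fun i hi => ?_
      have hi := mem_range.1 hi
      simp only [div_eq_mul_one_div (_ - _)]
      exact mul_le_mul_of_nonpos_left
        (one_div_le_one_div_of_le hpl (hanti i l (by omega) hlq))
        (sub_nonpos.2 (hprob i (by omega)).2)
    have htail : ∑ i ∈ range q \ range (l + 1), probSumLe p (i + 1) τ / p l ≤
        ∑ i ∈ range q \ range (l + 1), probSumLe p (i + 1) τ / p i := by
      refine sum_le_sum fun i hi => ?_
      simp only [mem_sdiff, mem_range] at hi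
      exact div_le_div_of_nonneg_left (hprob i hi.1).1 (hp_pos i hi.1)
        (hanti l i (by omega) hi.1)
    have htotal := sum_probSumLe_div_le p q τ hp
    rw [← sum_sdiff hsub] at htotal ⊢
    simp only [sub_div, sum_sub_distrib] at hhead
    simp only [← sum_div, sum_const, card_range, nsmul_eq_mul, mul_one] at hhead htail
    push_cast at hhead
    have hneg : (∑ i ∈ range q \ range (l + 1), probSumLe p (i + 1) τ +
        ∑ i ∈ range (l + 1), probSumLe p (i + 1) τ - ((l : ℝ) + 1)) / p l < 0 := by
      rw [sub_div, add_div]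
      linarith
    have := (div_neg_iff.1 hneg).resolve_left fun h => hpl.not_gt h.2
    linarith [this.1]
end

section
/- Let τ ∈ ℕ and let G₁, G₂, …, G_q be independent geometric random variables with parameters p₁, p₂, …, p_q satisfying 1 ≥ p₁ ≥ p₂ ≥ … ≥ p_q > 0. Let l be the largest integer ℓ with 0 ≤ ℓ ≤ q such that Σ_{i=1}^{ℓ} 1/p_i ≤ τ. Then l − 2·√(l + 1/4) < Σ_{i=1}^{q} Pr(G₁ + G₂ + ⋯ + G_i ≤ τ). -/
open Finset

/-- The joint mass of the tuples in `{1, …, N}ⁿ` with total at most `t`. -/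
noncomputable def boxSumLe (p : ℕ → ℝ) (N n t : ℕ) : ℝ :=
  ∑ k ∈ (Fintype.piFinset fun _ : Fin n => Finset.Icc 1 N).filter
      (fun k => ∑ j, k j ≤ t),
    ∏ j : Fin n, p j * (1 - p j) ^ (k j - 1)

lemma boxSumLe_nonneg {p : ℕ → ℝ} {n : ℕ} (h0 : ∀ i < n, 0 < p i) (h1 : ∀ i < n, p i ≤ 1)
    (N t : ℕ) : 0 ≤ boxSumLe p N n t :=
  Finset.sum_nonneg fun _ _ => Finset.prod_nonneg fun j _ =>
    mul_nonneg (h0 j j.2).le (pow_nonneg (sub_nonneg.2 (h1 j j.2)) _)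

lemma boxSumLe_zero (p : ℕ → ℝ) (N t : ℕ) : boxSumLe p N 0 t = 1 := by
  simp [boxSumLe]

/-- Conditioning on the value of the last variable. -/
lemma boxSumLe_succ (p : ℕ → ℝ) {N t : ℕ} (n : ℕ) (ht : t ≤ N) :
    boxSumLe p N (n + 1) t =
      ∑ k ∈ Finset.Icc 1 t, p n * (1 - p n) ^ (k - 1) * boxSumLe p N n (t - k) := by
  simp only [boxSumLe, Finset.mul_sum]
  rw [Finset.sum_sigma']
  refine Finset.sum_bij' (fun k _ => ⟨k (Fin.last n), fun j => k j.castSucc⟩)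
    (fun x _ => Fin.snoc (α := fun _ => ℕ) x.2 x.1) ?_ ?_ ?_ ?_ ?_
  · intro k hk
    simp only [Finset.mem_filter, Fintype.mem_piFinset, Finset.mem_Icc, Fin.sum_univ_castSucc]
      at hk
    simp only [Finset.mem_sigma, Finset.mem_filter, Fintype.mem_piFinset, Finset.mem_Icc]
    have := hk.1 (Fin.last n)
    exact ⟨by omega, fun j => hk.1 _, by omega⟩
  · rintro ⟨m, k⟩ hk
    simp only [Finset.mem_sigma, Finset.mem_filter, Fintype.mem_piFinset, Finset.mem_Icc] at hk
    simp only [Finset.mem_filter, Fintype.mem_piFinset, Finset.mem_Icc, Fin.sum_univ_castSucc,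
      Fin.snoc_castSucc, Fin.snoc_last]
    refine ⟨fun j => ?_, by omega⟩
    induction j using Fin.lastCases with
    | last => simp only [Fin.snoc_last]; omega
    | cast j => simpa only [Fin.snoc_castSucc] using hk.2.1 j
  · intro k _
    exact Fin.snoc_init_self k
  · rintro ⟨m, k⟩ _
    simp
  · intro k _
    simp only [Fin.prod_univ_castSucc, Fin.val_castSucc, Fin.val_last]
    ring

lemma sum_Icc_geometric (p : ℝ) (t : ℕ) :
    ∑ k ∈ Finset.Icc 1 t, p * (1 - p) ^ (k - 1) = 1 - (1 - p) ^ t := by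
  induction t with
  | zero => simp
  | succ t ih =>
    rw [Finset.sum_Icc_succ_top (by omega), ih, Nat.add_sub_cancel]
    ring

/-- Truncated second moment of a geometric variable about an arbitrary point. -/
lemma sum_Icc_geometric_mul_sq {p : ℝ} (hp : 0 < p) (b : ℝ) (t : ℕ) :
    ∑ k ∈ Finset.Icc 1 t, p * (1 - p) ^ (k - 1) * (k + b) ^ 2 =
      (1 - p) / p ^ 2 + (1 / p + b) ^ 2
        - (1 - p) ^ t * ((1 - p) / p ^ 2 + (t + 1 / p + b) ^ 2) := by
  induction t with
  | zero => simp
  | succ t ih =>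
    rw [Finset.sum_Icc_succ_top (by omega), ih, Nat.add_sub_cancel]
    push_cast
    field_simp
    ring

/-- A Chebyshev inequality for the upper tail, centred at an arbitrary point `a ≤ t`. -/
lemma one_sub_boxSumLe_mul_sq_le {p : ℕ → ℝ} {N : ℕ} (n : ℕ)
    (h0 : ∀ i < n, 0 < p i) (h1 : ∀ i < n, p i ≤ 1) (t : ℕ) (ht : t ≤ N) (a : ℝ)
    (ha : a ≤ t) :
    (1 - boxSumLe p N n t) * (t - a) ^ 2 ≤
      ∑ i ∈ Finset.range n, (1 - p i) / p i ^ 2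
        + (∑ i ∈ Finset.range n, 1 / p i - a) ^ 2 := by
  induction n generalizing t a with
  | zero => simp [boxSumLe_zero, sq_nonneg]
  | succ n ih =>
    have hp := h0 n n.lt_succ_self
    have hp1 := sub_nonneg.2 (h1 n n.lt_succ_self)
    rw [boxSumLe_succ p n ht, Finset.sum_range_succ, Finset.sum_range_succ]
    set V := ∑ i ∈ Finset.range n, (1 - p i) / p i ^ 2
    set μ := ∑ i ∈ Finset.range n, 1 / p i
    have hV : 0 ≤ V := Finset.sum_nonneg fun i hi =>
      div_nonneg (sub_nonneg.2 (h1 i (by simp at hi; omega))) (sq_nonneg _)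
    have hμ : 0 ≤ μ := Finset.sum_nonneg fun i hi =>
      one_div_nonneg.2 (h0 i (by simp at hi; omega)).le
    have hstep : ∑ k ∈ Finset.Icc 1 t, p n * (1 - p n) ^ (k - 1)
          * ((1 - boxSumLe p N n (t - k)) * (t - a) ^ 2)
        ≤ ∑ k ∈ Finset.Icc 1 t, p n * (1 - p n) ^ (k - 1) * (V + (k + (μ - a)) ^ 2) := by
      refine Finset.sum_le_sum fun k hk => ?_
      rw [Finset.mem_Icc] at hk
      refine mul_le_mul_of_nonneg_left ?_ (mul_nonneg hp.le (pow_nonneg hp1 _))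
      have hcast : ((t - k : ℕ) : ℝ) = t - k := Nat.cast_sub hk.2
      have := ih (fun i hi => h0 i (by omega)) (fun i hi => h1 i (by omega)) (t - k) (by omega)
        (a - k) (by rw [hcast]; linarith)
      rw [hcast] at this
      rwa [sub_sub_sub_cancel_right, sub_sub_eq_add_sub, add_sub_right_comm,
        add_comm (μ - a)] at this
    have hleft : (1 - ∑ k ∈ Finset.Icc 1 t,
          p n * (1 - p n) ^ (k - 1) * boxSumLe p N n (t - k)) * (t - a) ^ 2
        = ∑ k ∈ Finset.Icc 1 t, p n * (1 - p n) ^ (k - 1)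
            * ((1 - boxSumLe p N n (t - k)) * (t - a) ^ 2) + (1 - p n) ^ t * (t - a) ^ 2 := by
      simp only [← mul_assoc, ← Finset.sum_mul, mul_sub, mul_one, Finset.sum_sub_distrib,
        sum_Icc_geometric]
      ring
    have hright : ∑ k ∈ Finset.Icc 1 t, p n * (1 - p n) ^ (k - 1) * (V + (k + (μ - a)) ^ 2)
        = (1 - (1 - p n) ^ t) * V + ((1 - p n) / p n ^ 2 + (1 / p n + (μ - a)) ^ 2
          - (1 - p n) ^ t * ((1 - p n) / p n ^ 2 + (t + 1 / p n + (μ - a)) ^ 2)) := by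
      simp only [mul_add _ V, Finset.sum_add_distrib, ← Finset.sum_mul, sum_Icc_geometric,
        sum_Icc_geometric_mul_sq hp]
    have hv : 0 ≤ (1 - p n) / p n ^ 2 := div_nonneg hp1 (sq_nonneg _)
    have hinv : 0 ≤ 1 / p n := one_div_nonneg.2 hp.le
    have htail : (1 - p n) ^ t * (t - a) ^ 2
        ≤ (1 - p n) ^ t * (V + (1 - p n) / p n ^ 2 + (t + 1 / p n + (μ - a)) ^ 2) := by
      refine mul_le_mul_of_nonneg_left ?_ (pow_nonneg hp1 t)
      have : ((t : ℝ) - a) ^ 2 ≤ (t + 1 / p n + (μ - a)) ^ 2 :=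
        pow_le_pow_left₀ (by linarith) (by linarith) 2
      linarith
    rw [hleft]
    rw [hright] at hstep
    linear_combination hstep + htail

/-- For rates decreasing in the index, the sum of the first `i + 1` variables exceeds `τ` with
probability at most `l / (l - 1 - i) ^ 2` as soon as the first `l` means add up to at most `τ`. -/
lemma one_sub_probSumLe_mul_sq_le {p : ℕ → ℝ} {l τ i : ℕ} (h0 : ∀ j < l, 0 < p j)
    (h1 : ∀ j < l, p j ≤ 1) (hanti : ∀ j k, j ≤ k → k < l → p k ≤ p j)
    (hl : ∑ j ∈ Finset.range l, 1 / p j ≤ (τ : ℝ)) (hi : i < l) :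
    (1 - probSumLe p (i + 1) τ) * (l - 1 - i : ℝ) ^ 2 ≤ l := by
  have hil : (i : ℝ) + 1 ≤ l := by exact_mod_cast hi
  rcases le_total (1 - probSumLe p (i + 1) τ) 0 with hx | hx
  · exact (mul_nonpos_of_nonpos_of_nonneg hx (sq_nonneg _)).trans l.cast_nonneg
  have hp := h0 i hi
  have hsplit := Finset.sum_range_add_sum_Ico (fun j => 1 / p j) (Nat.succ_le_of_lt hi)
  have hrest : (l - 1 - i : ℝ) * (1 / p i) ≤ ∑ j ∈ Finset.Ico (i + 1) l, 1 / p j := by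
    have := Finset.card_nsmul_le_sum (Finset.Ico (i + 1) l) (fun j => 1 / p j) (1 / p i)
      fun j hj => by
        rw [Finset.mem_Ico] at hj
        exact one_div_le_one_div_of_le (h0 j hj.2) (hanti i j (by omega) hj.2)
    rw [Nat.card_Ico, nsmul_eq_mul, Nat.cast_sub hi] at this
    push_cast at this
    rwa [← sub_sub, sub_right_comm] at this
  have hvar : ∑ j ∈ Finset.range (i + 1), (1 - p j) / p j ^ 2 ≤ (i + 1) * (1 / p i ^ 2) := by
    have := Finset.sum_le_card_nsmul (Finset.range (i + 1)) (fun j => (1 - p j) / p j ^ 2)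
      (1 / p i ^ 2) fun j hj => by
        rw [Finset.mem_range] at hj
        have := h0 j (by omega)
        exact div_le_div₀ zero_le_one (by linarith) (by positivity)
          (pow_le_pow_left₀ hp.le (hanti j i (by omega) hi) 2)
    simpa using this
  have hgap : (l - 1 - i : ℝ) * (1 / p i) ≤ τ - ∑ j ∈ Finset.range (i + 1), 1 / p j := by
    simp only [Nat.succ_eq_add_one] at hsplit
    linarith
  have hdi : 0 ≤ (l - 1 - i : ℝ) * (1 / p i) :=
    mul_nonneg (by linarith) (one_div_nonneg.2 hp.le)
  have hcheb := one_sub_boxSumLe_mul_sq_le (N := τ) (i + 1) (fun j hj => h0 j (by omega))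
    (fun j hj => h1 j (by omega)) τ le_rfl (∑ j ∈ Finset.range (i + 1), 1 / p j) (by linarith)
  rw [sub_self, zero_pow two_ne_zero, add_zero] at hcheb
  have hmain : (1 - probSumLe p (i + 1) τ) * ((l - 1 - i : ℝ) * (1 / p i)) ^ 2
      ≤ (i + 1) * (1 / p i ^ 2) :=
    (mul_le_mul_of_nonneg_left (pow_le_pow_left₀ hdi hgap 2) hx).trans (hcheb.trans hvar)
  rw [mul_pow, div_pow, one_pow, ← mul_assoc] at hmain
  exact (le_of_mul_le_mul_right hmain (by positivity)).trans hil

/-- Bounding terms by `1` up to index `s` and by a telescoping sum afterwards. -/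
lemma sum_range_le_of_mul_sq_le {x : ℕ → ℝ} {c : ℝ} {s n : ℕ} (hc : 0 ≤ c) (hs : 0 < s)
    (hn : s + 1 ≤ n) (h1 : ∀ d < n, x d ≤ 1) (h2 : ∀ d < n, x d * (d : ℝ) ^ 2 ≤ c) :
    ∑ d ∈ Finset.range n, x d ≤ s + 1 + c / s - c / (n - 1) := by
  induction n, hn using Nat.le_induction with
  | base =>
    have := Finset.sum_le_card_nsmul (Finset.range (s + 1)) x 1 fun d hd =>
      h1 d (Finset.mem_range.1 hd)
    simpa using this
  | succ n hn ih =>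
    have ih := ih (fun d hd => h1 d (by omega)) (fun d hd => h2 d (by omega))
    have hn1 : (0 : ℝ) < n - 1 := by
      have : (2 : ℝ) ≤ n := by exact_mod_cast (by omega : 2 ≤ n)
      linarith
    have hn0 : (0 : ℝ) < n := by linarith
    have hx : x n ≤ c / (n : ℝ) ^ 2 := (le_div_iff₀ (by positivity)).2 (h2 n n.lt_succ_self)
    have htel : c / (n : ℝ) ^ 2 ≤ c / (n - 1) - c / n := by
      have : c / ((n : ℝ) - 1) - c / n = c / ((n - 1) * n) := by
        field_simp
        ring
      rw [this]
      exact div_le_div_of_nonneg_left hc (by positivity) (by nlinarith)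
    rw [Finset.sum_range_succ]
    push_cast
    rw [add_sub_cancel_right]
    linarith

lemma exists_nearest_sqrt (l : ℕ) : ∃ s : ℕ, l ≤ s ^ 2 + s ∧ s ^ 2 ≤ l + s := by
  have h1 := Nat.sqrt_le' l
  have h2 := Nat.lt_succ_sqrt' l
  rcases le_total l (Nat.sqrt l ^ 2 + Nat.sqrt l) with h | h
  · exact ⟨Nat.sqrt l, h, by omega⟩
  · refine ⟨Nat.sqrt l + 1, ?_, ?_⟩ <;> simp only [Nat.succ_eq_add_one] at * <;> nlinarith

lemma add_div_le_two_mul_sqrt {l s : ℕ} (hs : 0 < s) (h1 : l ≤ s ^ 2 + s)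
    (h2 : s ^ 2 ≤ l + s) : (s : ℝ) + l / s ≤ 2 * Real.sqrt (l + 1 / 4) := by
  have hs' : (0 : ℝ) < s := by exact_mod_cast hs
  have h1' : (l : ℝ) ≤ s ^ 2 + s := by exact_mod_cast h1
  have h2' : (s : ℝ) ^ 2 ≤ l + s := by exact_mod_cast h2
  have hlow : -1 ≤ (s : ℝ) - l / s := by
    have : (l : ℝ) / s ≤ s + 1 := (div_le_iff₀ hs').2 (by linarith)
    linarith
  have hupp : (s : ℝ) - l / s ≤ 1 := by
    have : (s : ℝ) - 1 ≤ l / s := (le_div_iff₀ hs').2 (by linarith)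
    linarith
  have hmul : (s : ℝ) * (l / s) = l := mul_div_cancel₀ _ hs'.ne'
  have : ((s : ℝ) + l / s) / 2 ≤ Real.sqrt (l + 1 / 4) := Real.le_sqrt_of_sq_le (by nlinarith)
  linarith

/-- if `1 ≥ p₁ ≥ ⋯ ≥ p_q > 0` and `l` is the largest `ℓ ≤ q` with
`Σ_{i=1}^{ℓ} 1/p_i ≤ τ`, then `l - 2√(l + 1/4) < Σ_{i=1}^{q} Pr(G₁ + ⋯ + G_i ≤ τ)`. -/
theorem stmt1 (τ q : ℕ) (p : ℕ → ℝ)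
    (hp_le : ∀ i < q, p i ≤ 1) (hp_pos : ∀ i < q, 0 < p i)
    (hmono : ∀ i, i + 1 < q → p (i + 1) ≤ p i)
    (l : ℕ) (hlq : l ≤ q)
    (hl : ∑ i ∈ Finset.range l, 1 / p i ≤ (τ : ℝ))
    (hlmax : ∀ m ≤ q, ∑ i ∈ Finset.range m, 1 / p i ≤ (τ : ℝ) → m ≤ l) :
    (l : ℝ) - 2 * Real.sqrt ((l : ℝ) + 1 / 4) <
      ∑ i ∈ Finset.range q, probSumLe p (i + 1) τ := by
  have hnonneg : ∀ i < q, 0 ≤ probSumLe p (i + 1) τ := fun i hi =>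
    boxSumLe_nonneg (fun j hj => hp_pos j (by omega)) (fun j hj => hp_le j (by omega)) τ τ
  have hanti : ∀ j k, j ≤ k → k < l → p k ≤ p j := by
    intro j k hjk
    induction k, hjk using Nat.le_induction with
    | base => exact fun _ => le_rfl
    | succ k _ ih => exact fun hk => (hmono k (by omega)).trans (ih (by omega))
  have hsub : ∑ i ∈ Finset.range l, probSumLe p (i + 1) τ
      ≤ ∑ i ∈ Finset.range q, probSumLe p (i + 1) τ :=
    Finset.sum_le_sum_of_subset_of_nonneg (Finset.range_mono hlq)
      fun i hi _ => hnonneg i (Finset.mem_range.1 hi)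
  refine lt_of_lt_of_le ?_ hsub
  rcases lt_or_ge l 5 with hsmall | hlarge
  · have h0 : 0 ≤ ∑ i ∈ Finset.range l, probSumLe p (i + 1) τ :=
      Finset.sum_nonneg fun i hi => hnonneg i ((Finset.mem_range.1 hi).trans_le hlq)
    have hl4 : (l : ℝ) ≤ 4 := by exact_mod_cast (by omega : l ≤ 4)
    have : (l : ℝ) / 2 < Real.sqrt (l + 1 / 4) :=
      Real.lt_sqrt_of_sq_lt (by nlinarith [(l.cast_nonneg : (0 : ℝ) ≤ l)])
    linarith
  obtain ⟨s, hs1, hs2⟩ := exists_nearest_sqrt l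
  have hs : 2 ≤ s := by nlinarith
  have hsl : s + 1 ≤ l := by nlinarith
  have hsum := sum_range_le_of_mul_sq_le (x := fun d => 1 - probSumLe p (l - 1 - d + 1) τ)
    (c := l) (s := s) (n := l) l.cast_nonneg (by omega) hsl
    (fun d hd => by simpa using hnonneg (l - 1 - d) (by omega))
    (fun d hd => by
      have := one_sub_probSumLe_mul_sq_le (i := l - 1 - d) (fun j hj => hp_pos j (by omega))
        (fun j hj => hp_le j (by omega)) hanti hl (by omega)
      convert this using 3
      rw [Nat.cast_sub (by omega), Nat.cast_sub (by omega)]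
      push_cast
      ring)
  rw [Finset.sum_range_reflect (fun i => 1 - probSumLe p (i + 1) τ) l, Finset.sum_sub_distrib,
    Finset.sum_const, Finset.card_range, nsmul_eq_mul, mul_one] at hsum
  have hsqrt := add_div_le_two_mul_sqrt (by omega) hs1 hs2
  have hl5 : (5 : ℝ) ≤ l := by exact_mod_cast hlarge
  have hlast : 1 < (l : ℝ) / (l - 1) := (one_lt_div (by linarith)).2 (by linarith)
  linarith
end

section
/- Let τ, q ∈ ℕ and let G₁, G₂, …, G_q be independent geometric random variables with parameters p₁, p₂, …, p_q ∈ (0,1]. Suppose p_d < p_{d+1} for some d ∈ {1, …, q−1}, and let G′₁, G′₂, …, G′_q be independent geometric random variables (independent of the G_i's) with parameters p₁, …, p_{d−1}, p_{d+1}, p_d, p_{d+2}, …, p_q (i.e., the parameters in positions d and d+1 are swapped). Then Σ_{i=1}^{q} Pr(G₁ + ⋯ + G_i ≤ τ) ≤ Σ_{i=1}^{q} Pr(G′₁ + ⋯ + G′_i ≤ τ). -/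
open Finset

theorem sum_geometric_mass (x : ℝ) (n : ℕ) :
    ∑ m ∈ Finset.Icc 1 n, x * (1 - x) ^ (m - 1) = 1 - (1 - x) ^ n := by
  induction n with
  | zero => simp
  | succ n ih =>
    rw [Finset.sum_Icc_succ_top (by omega), ih]
    simp only [Nat.add_sub_cancel]
    ring

theorem probSumLe_succ (p : ℕ → ℝ) (n τ : ℕ) :
    probSumLe p (n + 1) τ =
      ∑ k ∈ (Fintype.piFinset fun _ : Fin n => Finset.Icc 1 τ).filter
          (fun k => ∑ j, k j ≤ τ),
        (∏ j : Fin n, p j * (1 - p j) ^ (k j - 1)) *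
          (1 - (1 - p n) ^ (τ - ∑ j, k j)) := by
  simp_rw [← sum_geometric_mass, Finset.mul_sum]
  rw [Finset.sum_sigma', probSumLe]
  refine Finset.sum_bij' (fun k _ => ⟨fun j => k j.castSucc, k (Fin.last n)⟩)
    (fun x _ => Fin.snoc (α := fun _ => ℕ) x.1 x.2) ?_ ?_ ?_ ?_ ?_
  · intro k hk
    simp only [Finset.mem_filter, Fintype.mem_piFinset, Finset.mem_Icc,
      Fin.sum_univ_castSucc, Finset.mem_sigma] at hk ⊢
    have := hk.1 (Fin.last n)
    exact ⟨⟨fun j => hk.1 _, by omega⟩, by omega, by omega⟩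
  · rintro ⟨k, m⟩ hk
    simp only [Finset.mem_filter, Fintype.mem_piFinset, Finset.mem_Icc,
      Fin.sum_univ_castSucc, Finset.mem_sigma, Fin.forall_fin_succ', Fin.snoc_castSucc,
      Fin.snoc_last] at hk ⊢
    exact ⟨⟨hk.1.1, by omega, by omega⟩, by omega⟩
  · intro k _
    exact Fin.snoc_init_self k
  · rintro ⟨k, m⟩ _
    simp
  · intro k _
    simp [Fin.prod_univ_castSucc]

theorem probSumLe_congr {p p' : ℕ → ℝ} {n : ℕ} (h : ∀ j < n, p j = p' j) (τ : ℕ) :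
    probSumLe p n τ = probSumLe p' n τ := by
  unfold probSumLe
  refine Finset.sum_congr rfl fun k _ => Finset.prod_congr rfl fun j _ => ?_
  rw [h j j.isLt]

theorem probSumLe_eq_of_perm {p p' : ℕ → ℝ} {n : ℕ} (e : Equiv.Perm (Fin n))
    (h : ∀ j : Fin n, p' j = p (e j)) (τ : ℕ) :
    probSumLe p n τ = probSumLe p' n τ := by
  unfold probSumLe
  refine Finset.sum_equiv (e.symm.arrowCongr (Equiv.refl ℕ)) ?_ ?_
  · intro k
    have hs : ∑ j, k (e j) = ∑ j, k j := Equiv.sum_comp e k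
    simp only [Finset.mem_filter, Fintype.mem_piFinset, Equiv.arrowCongr_apply, Function.comp,
      Equiv.symm_symm, Equiv.refl_apply, hs]
    exact and_congr_left' (e.forall_congr_right (q := fun j => k j ∈ Finset.Icc 1 τ)).symm
  · intro k _
    simp only [Equiv.arrowCongr_apply, Function.comp, Equiv.symm_symm, Equiv.refl_apply, h]
    exact (Equiv.prod_comp e fun j => p j * (1 - p j) ^ (k j - 1)).symm

theorem probSumLe_succ_le {p p' : ℕ → ℝ} {n : ℕ} (h : ∀ j < n, p j = p' j)
    (h_nonneg : ∀ j < n, 0 ≤ p j) (h_le_one : ∀ j < n, p j ≤ 1)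
    (hn : p n ≤ p' n) (hn' : p' n ≤ 1) (τ : ℕ) :
    probSumLe p (n + 1) τ ≤ probSumLe p' (n + 1) τ := by
  rw [probSumLe_succ, probSumLe_succ]
  refine Finset.sum_le_sum fun k _ => ?_
  have hprod : ∏ j : Fin n, p' j * (1 - p' j) ^ (k j - 1) =
      ∏ j : Fin n, p j * (1 - p j) ^ (k j - 1) :=
    Finset.prod_congr rfl fun j _ => by rw [h j j.isLt]
  rw [hprod]
  refine mul_le_mul_of_nonneg_left ?_ (Finset.prod_nonneg fun j _ => ?_)
  · have := pow_le_pow_left₀ (sub_nonneg.2 hn') (sub_le_sub_left hn 1) (τ - ∑ j, k j)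
    linarith
  · exact mul_nonneg (h_nonneg j j.isLt) (pow_nonneg (sub_nonneg.2 (h_le_one j j.isLt)) _)

/-- adjacent-swap lemma: swapping the parameters in positions
`d` and `d+1` (with `p d < p (d+1)`) does not decrease
`Σ_{i=1}^{q} Pr(G₁ + ⋯ + G_i ≤ τ)`.  Positions are 0-indexed, so the paper's
`d ∈ {1, …, q-1}` becomes `d + 1 < q`. -/
theorem stmt2 (τ q : ℕ) (p : ℕ → ℝ)
    (hp_pos : ∀ i < q, 0 < p i) (hp_le : ∀ i < q, p i ≤ 1)
    (d : ℕ) (hd : d + 1 < q) (hswap : p d < p (d + 1)) :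
    ∑ i ∈ Finset.range q, probSumLe p (i + 1) τ ≤
      ∑ i ∈ Finset.range q,
        probSumLe (fun j => if j = d then p (d + 1) else
          if j = d + 1 then p d else p j) (i + 1) τ := by
  refine Finset.sum_le_sum fun i hi => ?_
  rw [Finset.mem_range] at hi
  rcases lt_trichotomy i d with h | rfl | h
  · refine (probSumLe_congr (fun j hj => ?_) τ).le
    rw [if_neg (by omega), if_neg (by omega)]
  · refine probSumLe_succ_le (fun j hj => ?_) (fun j hj => (hp_pos j (by omega)).le)
      (fun j hj => hp_le j (by omega)) ?_ ?_ τ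
    · rw [if_neg (by omega), if_neg (by omega)]
    · simpa using hswap.le
    · simpa using hp_le _ hd
  · refine (probSumLe_eq_of_perm
      (Equiv.swap (⟨d, by omega⟩ : Fin (i + 1)) ⟨d + 1, by omega⟩) (fun j => ?_) τ).le
    rw [Equiv.swap_apply_def]
    simp only [Fin.ext_iff]
    split_ifs <;> rfl
end

section
/- For every integer l with l > 1, one has 1 + Σ_{i=1}^{l−1} min(1, i/(l−i)²) < 2·√(l + 1/4). -/
open Finset

/-- Splitting a sum of truncated terms at `m` and telescoping `1 / j ^ 2 ≤ 1 / (j - 1) - 1 / j`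
beyond `m`. -/
lemma sum_min_one_le (L : ℝ) (m : ℕ) (hm : 1 ≤ m) (n : ℕ) (hmn : m ≤ n) (hn : (n : ℝ) ≤ L - 1) :
    ∑ j ∈ Finset.Icc 1 n, min 1 ((L - (j : ℝ)) / (j : ℝ) ^ 2) ≤
      m + L * (1 / m - 1 / n) - (n - m) / (L - 1) := by
  induction n, hmn using Nat.le_induction with
  | base =>
    calc ∑ j ∈ Finset.Icc 1 m, min 1 ((L - (j : ℝ)) / (j : ℝ) ^ 2)
        ≤ ∑ _j ∈ Finset.Icc 1 m, (1 : ℝ) := Finset.sum_le_sum fun _ _ => min_le_left _ _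
      _ = _ := by simp
  | succ n hmn ih =>
    push_cast at hn
    rw [Finset.sum_Icc_succ_top (by omega)]
    have hn1 : (1 : ℝ) ≤ n := by exact_mod_cast hm.trans hmn
    have hL : 0 < L - 1 := by linarith
    have hsq : 1 / ((n : ℝ) + 1) ^ 2 ≤ 1 / n - 1 / (n + 1) := by
      rw [div_sub_div _ _ (by positivity) (by positivity), div_le_div_iff₀ (by positivity)
        (by positivity)]
      nlinarith
    have hinv : 1 / (L - 1) ≤ 1 / ((n : ℝ) + 1) := one_div_le_one_div_of_le (by positivity) hn
    have hterm : min 1 ((L - ((n + 1 : ℕ) : ℝ)) / ((n + 1 : ℕ) : ℝ) ^ 2) ≤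
        L * (1 / n - 1 / (n + 1)) - 1 / (L - 1) := by
      refine (min_le_right _ _).trans ?_
      have hsplit : (L - ((n + 1 : ℕ) : ℝ)) / ((n + 1 : ℕ) : ℝ) ^ 2 =
          L * (1 / ((n : ℝ) + 1) ^ 2) - 1 / (n + 1) := by
        push_cast
        field_simp
      have := mul_le_mul_of_nonneg_left hsq (by linarith : (0 : ℝ) ≤ L)
      linarith
    have := ih (by linarith)
    have hdiv : (((n + 1 : ℕ) : ℝ) - m) / (L - 1) = (n - m) / (L - 1) + 1 / (L - 1) := by
      push_cast
      ring
    rw [hdiv]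
    push_cast at hterm ⊢
    linarith

/-- for every integer `l > 1`,
`1 + Σ_{i=1}^{l-1} min(1, i/(l-i)²) < 2·√(l + 1/4)`. -/
theorem stmt5 (l : ℕ) (hl : 1 < l) :
    1 + ∑ i ∈ Finset.Icc 1 (l - 1), min 1 ((i : ℝ) / ((l : ℝ) - (i : ℝ)) ^ 2) <
      2 * Real.sqrt ((l : ℝ) + 1 / 4) := by
  have hreflect : ∑ i ∈ Finset.Icc 1 (l - 1), min 1 ((i : ℝ) / ((l : ℝ) - (i : ℝ)) ^ 2) =
      ∑ j ∈ Finset.Icc 1 (l - 1), min 1 (((l : ℝ) - (j : ℝ)) / (j : ℝ) ^ 2) := by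
    refine Finset.sum_nbij' (fun i => l - i) (fun i => l - i) ?_ ?_ ?_ ?_ ?_ <;>
      intro i hi <;> simp only [Finset.mem_Icc] at hi ⊢
    · omega
    · omega
    · omega
    · omega
    · rw [Nat.cast_sub (by omega : i ≤ l), sub_sub_cancel]
  rw [hreflect]
  set m := Nat.sqrt l with hm_def
  have hm : 1 ≤ m := Nat.sqrt_pos.2 (by omega)
  have hml : m < l := Nat.sqrt_lt_self hl
  have hbound := sum_min_one_le l m hm (l - 1) (by omega) (by rw [Nat.cast_sub hl.le]; simp)
  rw [Nat.cast_sub hl.le, Nat.cast_one] at hbound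
  have hlR : (1 : ℝ) < l := by exact_mod_cast hl
  have hmR : (1 : ℝ) ≤ m := by exact_mod_cast hm
  have hmlR : (m : ℝ) + 1 ≤ l := by exact_mod_cast hml
  have hl1 : (0 : ℝ) < l - 1 := by linarith
  have hs : Real.sqrt l ^ 2 = l := Real.sq_sqrt (by positivity)
  have hms : (m : ℝ) ≤ Real.sqrt l := Real.nat_sqrt_le_real_sqrt
  have hsm : Real.sqrt l ≤ m + 1 := Real.real_sqrt_le_nat_sqrt_succ
  have hlt : Real.sqrt l < Real.sqrt ((l : ℝ) + 1 / 4) :=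
    Real.sqrt_lt_sqrt (by positivity) (by linarith)
  have hdiv : (l : ℝ) / m ≤ 2 * Real.sqrt l - m + 1 / m := by
    rw [div_le_iff₀ (by positivity), add_mul, one_div_mul_cancel (by positivity)]
    nlinarith
  have hinv : 1 / (m : ℝ) ≤ ((l : ℝ) - m) / (l - 1) := by
    rw [div_le_div_iff₀ (by positivity) hl1]
    nlinarith
  have hsum : 1 + ((m : ℝ) + l * (1 / m - 1 / (l - 1)) - (l - 1 - m) / (l - 1)) =
      m + l / m - (l - m) / (l - 1) := by
    field_simp
    ring
  linarith
end

section
/- Let N, M ∈ ℕ, let τ > 0, and let p_{ij} ∈ (0,1] for i ∈ {1,…,N}, j ∈ {1,…,M}. Let C_det be the maximum of Σ_{i=1}^{N} Σ_{j=1}^{M} x_{ij} over all x with x_{ij} ∈ {0,1} satisfying Σ_{j=1}^{M} x_{ij}/p_{ij} ≤ τ for each i and Σ_{i=1}^{N} x_{ij} ≤ 1 for each j. Suppose x* ∈ ℝ^{N×M} is feasible for the linear-programming relaxation (i.e., satisfies Σ_{j=1}^{M} x*_{ij}/p_{ij} ≤ τ for each i, Σ_{i=1}^{N} x*_{ij}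 ≤ 1 for each j, and x*_{ij} ≥ 0 for all i,j), attains the maximum of Σ_{i,j} x_{ij} over all such feasible points, and is basic in the sense that the total number of these N + M + N·M constraints that hold with equality at x* is at least N·M. Then C_det − Σ_{i=1}^{N} Σ_{j=1}^{M} ⌊x*_{ij}⌋ ≤ N. -/
open Finset

/-- Each nonzero entry exceeds its floor by strictly less than one, so a family of sum exactly one
gains a full unit by integrality. -/
lemma sum_add_ite_le_sum_floor_add_card {ι : Type*} [Fintype ι] (f : ι → ℝ) :
    ∑ i, f i + (if ∑ i, f i = 1 then 1 else 0) ≤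
      ∑ i, (⌊f i⌋ : ℝ) + ∑ i, (if f i = 0 then 0 else 1 : ℝ) := by
  have hle : ∀ i, f i ≤ (⌊f i⌋ : ℝ) + (if f i = 0 then 0 else 1 : ℝ) := by
    intro i
    split_ifs with h
    · simp [h]
    · exact (Int.lt_floor_add_one _).le
  rw [← Finset.sum_add_distrib]
  by_cases h1 : ∑ i, f i = 1
  · obtain ⟨k, -, hk⟩ : ∃ k ∈ Finset.univ, f k ≠ 0 :=
      Finset.exists_ne_zero_of_sum_ne_zero (by rw [h1]; exact one_ne_zero)
    have hlt : ∑ i, f i < ∑ i, ((⌊f i⌋ : ℝ) + (if f i = 0 then 0 else 1 : ℝ)) := by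
      refine Finset.sum_lt_sum (fun i _ => hle i) ⟨k, Finset.mem_univ k, ?_⟩
      rw [if_neg hk]
      exact Int.lt_floor_add_one _
    have hint : ∑ i, ((⌊f i⌋ : ℝ) + (if f i = 0 then 0 else 1 : ℝ)) =
        ((∑ i, (⌊f i⌋ + if f i = 0 then 0 else 1) : ℤ) : ℝ) := by
      push_cast
      rfl
    rw [if_pos h1, h1]
    rw [h1, hint, ← Int.cast_one, Int.cast_lt] at hlt
    rw [hint]
    exact_mod_cast Int.cast_le (R := ℝ).mpr (Int.add_one_le_of_lt hlt)
  · rw [if_neg h1, add_zero]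
    exact Finset.sum_le_sum fun i _ => hle i

/-- LP rounding for the deterministic relaxation: if `Cdet` is the
optimal value of the 0-1 packing program and `xs` is a basic optimal solution of
its LP relaxation (basic: at least `N·M` of the `N + M + N·M` constraints are
tight at `xs`), then `Cdet − Σ_{i,j} ⌊xs i j⌋ ≤ N`. -/
theorem stmt7 (N M : ℕ) (τ : ℝ) (hτ : 0 < τ)
    (p : Fin N → Fin M → ℝ) (hp_pos : ∀ i j, 0 < p i j) (hp_le : ∀ i j, p i j ≤ 1)
    (Cdet : ℕ)
    -- `Cdet` is an upper bound on the value of every feasible 0-1 point …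
    (hub : ∀ x : Fin N → Fin M → ℕ, (∀ i j, x i j ≤ 1) →
      (∀ i, ∑ j, (x i j : ℝ) / p i j ≤ τ) → (∀ j, ∑ i, x i j ≤ 1) →
      (∑ i, ∑ j, x i j) ≤ Cdet)
    -- … and is attained by some feasible 0-1 point.
    (hach : ∃ x : Fin N → Fin M → ℕ, (∀ i j, x i j ≤ 1) ∧
      (∀ i, ∑ j, (x i j : ℝ) / p i j ≤ τ) ∧ (∀ j, ∑ i, x i j ≤ 1) ∧
      (∑ i, ∑ j, x i j) = Cdet)
    (xs : Fin N → Fin M → ℝ)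
    -- `xs` is feasible for the LP relaxation …
    (hx0 : ∀ i j, 0 ≤ xs i j)
    (hx1 : ∀ i, ∑ j, xs i j / p i j ≤ τ)
    (hx2 : ∀ j, ∑ i, xs i j ≤ 1)
    -- … optimal for it …
    (hopt : ∀ y : Fin N → Fin M → ℝ, (∀ i j, 0 ≤ y i j) →
      (∀ i, ∑ j, y i j / p i j ≤ τ) → (∀ j, ∑ i, y i j ≤ 1) →
      ∑ i, ∑ j, y i j ≤ ∑ i, ∑ j, xs i j)
    -- … and basic: at least `N·M` constraints are tight at `xs`.
    (hbasic : N * M ≤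
      (Finset.univ.filter (fun i : Fin N => ∑ j, xs i j / p i j = τ)).card
      + (Finset.univ.filter (fun j : Fin M => ∑ i, xs i j = 1)).card
      + (Finset.univ.filter (fun q : Fin N × Fin M => xs q.1 q.2 = 0)).card) :
    (Cdet : ℝ) - ∑ i, ∑ j, (⌊xs i j⌋ : ℝ) ≤ N := by
  obtain ⟨x, -, hxτ, hxc, hxsum⟩ := hach
  have hC : (Cdet : ℝ) ≤ ∑ i, ∑ j, xs i j := by
    rw [← hxsum]
    push_cast
    exact hopt (fun i j => (x i j : ℝ)) (fun i j => Nat.cast_nonneg _) hxτ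
      (fun j => by exact_mod_cast hxc j)
  have hround := Finset.sum_le_sum fun j (_ : j ∈ Finset.univ) =>
    sum_add_ite_le_sum_floor_add_card fun i => xs i j
  simp only [Finset.sum_add_distrib] at hround
  rw [Finset.sum_comm, Finset.sum_comm (f := fun j i => (⌊xs i j⌋ : ℝ)),
    Finset.sum_comm (f := fun j i => (if xs i j = 0 then 0 else 1 : ℝ)),
    Finset.sum_boole, ← Fintype.sum_prod_type' (f := fun i j => (if xs i j = 0 then 0 else 1 : ℝ))]
    at hround
  have hsplit : (∑ q : Fin N × Fin M, (if xs q.1 q.2 = 0 then 0 else 1 : ℝ)) +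
      (Finset.univ.filter (fun q : Fin N × Fin M => xs q.1 q.2 = 0)).card = (N : ℝ) * M := by
    rw [← Finset.sum_boole, ← Finset.sum_add_distrib,
      Finset.sum_congr rfl (g := fun _ => (1 : ℝ)) (fun q _ => by split_ifs <;> simp)]
    simp
  have hbins : ((Finset.univ.filter (fun i : Fin N => ∑ j, xs i j / p i j = τ)).card : ℝ) ≤ N := by
    exact_mod_cast (Finset.card_le_univ _).trans_eq (Fintype.card_fin N)
  have hbasic' := Nat.cast_le (α := ℝ).mpr hbasic
  push_cast at hbasic'
  linarith
end

section
/- Let τ, l ∈ ℕ with 1 ≤ l < τ, set p = l/τ, and let B be a binomial random variable with τ trials and success probability p. Then l − E[min(B, l)] = l · C(τ−1, l) · p^l · (1−p)^{τ−l} = τ · C(τ, l) · p^{l+1} · (1−p)^{τ−l+1}, where C(n, k) denotes the binomial coefficient. -/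
open Finset

/-- Partial sums of the centred binomial weights telescope. -/
theorem sum_range_mean_sub_mul_binomial {R : Type*} [CommRing R] (n : ℕ) (p : R) {m : ℕ}
    (hm : m ≤ n) :
    ∑ j ∈ Finset.range m, ((n : R) * p - j) * (n.choose j * p ^ j * (1 - p) ^ (n - j))
      = m * n.choose m * p ^ m * (1 - p) ^ (n - m + 1) := by
  induction m with
  | zero => simp
  | succ m ih =>
    rw [Finset.sum_range_succ, ih (by omega)]
    have hc : (n.choose (m + 1) : R) * (m + 1) = n.choose m * (n - m) := by
      have h := congrArg (Nat.cast : ℕ → R) (Nat.choose_succ_right_eq n m)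
      push_cast [Nat.cast_sub (show m ≤ n by omega)] at h
      exact h
    rw [show n - (m + 1) + 1 = n - m by omega]
    push_cast
    linear_combination (-(p ^ (m + 1) * (1 - p) ^ (n - m))) * hc

/-- The binomial weights sum to one. -/
theorem sum_range_binomial {R : Type*} [CommRing R] (n : ℕ) (p : R) :
    ∑ j ∈ Finset.range (n + 1), (n.choose j * p ^ j * (1 - p) ^ (n - j) : R) = 1 := by
  have h := add_pow p (1 - p) n
  rw [add_sub_cancel, one_pow] at h
  exact (Finset.sum_congr rfl fun j _ => by ring).trans h.symm

/-- The shortfall of a truncated binomial variable is a sum over the values below the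
truncation level. -/
theorem sub_sum_min_mul_binomial {R : Type*} [CommRing R] {n l : ℕ} (p : R) (hl : l ≤ n) :
    (l : R) - ∑ j ∈ Finset.range (n + 1),
        ((min j l : ℕ) : R) * n.choose j * p ^ j * (1 - p) ^ (n - j)
      = ∑ j ∈ Finset.range l, ((l : R) - j) * (n.choose j * p ^ j * (1 - p) ^ (n - j)) := by
  calc (l : R) - ∑ j ∈ Finset.range (n + 1),
        ((min j l : ℕ) : R) * n.choose j * p ^ j * (1 - p) ^ (n - j)
      = ∑ j ∈ Finset.range (n + 1),
          ((l : R) - (min j l : ℕ)) * (n.choose j * p ^ j * (1 - p) ^ (n - j)) := by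
        simp only [sub_mul, Finset.sum_sub_distrib, ← Finset.mul_sum, sum_range_binomial,
          mul_one]
        simp only [mul_assoc]
    _ = ∑ j ∈ Finset.range l,
          ((l : R) - (min j l : ℕ)) * (n.choose j * p ^ j * (1 - p) ^ (n - j)) := by
        refine (Finset.sum_subset (Finset.range_mono (by omega)) fun j _ hj => ?_).symm
        rw [min_eq_right (by simpa using hj), sub_self, zero_mul]
    _ = _ := Finset.sum_congr rfl fun j hj => by
        rw [min_eq_left (Finset.mem_range.mp hj).le]

/-- for `1 ≤ l < τ` and `p = l/τ`, with `B` binomial with `τ`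
trials and success probability `p` (so `E[min(B,l)]` is written out as
`Σ_{j=0}^{τ} min(j,l)·C(τ,j)·p^j·(1-p)^{τ-j}`):
`l − E[min(B,l)] = l·C(τ-1,l)·p^l·(1-p)^{τ-l} = τ·C(τ,l)·p^{l+1}·(1-p)^{τ-l+1}`. -/
theorem stmt8 (τ l : ℕ) (hl : 1 ≤ l) (hlτ : l < τ) :
    ((l : ℝ) - ∑ j ∈ Finset.range (τ + 1),
        ((min j l : ℕ) : ℝ) * (τ.choose j : ℝ) * ((l : ℝ) / τ) ^ j *
          (1 - (l : ℝ) / τ) ^ (τ - j)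
      = (l : ℝ) * ((τ - 1).choose l : ℝ) * ((l : ℝ) / τ) ^ l *
          (1 - (l : ℝ) / τ) ^ (τ - l))
    ∧ (l : ℝ) * ((τ - 1).choose l : ℝ) * ((l : ℝ) / τ) ^ l *
          (1 - (l : ℝ) / τ) ^ (τ - l)
      = (τ : ℝ) * (τ.choose l : ℝ) * ((l : ℝ) / τ) ^ (l + 1) *
          (1 - (l : ℝ) / τ) ^ (τ - l + 1) := by
  have hτ : (τ : ℝ) ≠ 0 := Nat.cast_ne_zero.mpr (by omega)
  have hp : (τ : ℝ) * ((l : ℝ) / τ) = l := mul_div_cancel₀ _ hτ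
  have hc : ((τ - 1).choose l : ℝ) = τ.choose l * (1 - (l : ℝ) / τ) := by
    obtain ⟨n, rfl⟩ : ∃ n, τ = n + 1 := ⟨τ - 1, by omega⟩
    have h := congrArg (Nat.cast : ℕ → ℝ) (Nat.choose_mul_succ_eq n l)
    rw [Nat.cast_mul, Nat.cast_mul, Nat.cast_sub hlτ.le] at h
    rw [Nat.add_sub_cancel, one_sub_div hτ, ← mul_div_assoc, eq_div_iff hτ]
    exact h
  have hsum := sum_range_mean_sub_mul_binomial τ ((l : ℝ) / τ) hlτ.le
  rw [hp] at hsum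
  constructor
  · rw [sub_sum_min_mul_binomial _ hlτ.le, hsum, hc]
    ring
  · rw [hc]
    linear_combination
      (-(τ.choose l * ((l : ℝ) / τ) ^ l * (1 - (l : ℝ) / τ) ^ (τ - l + 1))) * hp
end

section
/- Let p_d, p_{d+1} ∈ (0,1) with p_d ≠ p_{d+1}, let ω_d, ω_{d+1} be real numbers, and let G_d, G_{d+1}, G′_d, G′_{d+1} be independent geometric random variables with parameters p_d, p_{d+1}, p_{d+1}, p_d respectively. Then for every t ∈ ℕ, ω_{d+1}·Pr(G′_d ≤ t) + ω_d·Pr(G′_d + G′_{d+1} ≤ t) − ω_d·Pr(G_d ≤ t) − ω_{d+1}·Pr(G_d + G_{d+1} ≤ t) = (ω_{d+1} p_{d+1} − ω_d p_d) · ((1−p_{d+1})^t − (1−p_d)^t)/(p_d − p_{d+1}); in particular, this quantity is strictly positive for every t ≥ 1 whenever ω_{d+1} p_{d+1} > ω_d p_d. -/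
open Finset

theorem probSumLe_one (p : ℕ → ℝ) (t : ℕ) : probSumLe p 1 t = 1 - (1 - p 0) ^ t := by
  have h : probSumLe p 1 t = ∑ i ∈ range t, p 0 * (1 - p 0) ^ i := by
    refine Finset.sum_bij' (fun k _ => k 0 - 1) (fun i _ => ![i + 1]) ?_ ?_ ?_ ?_ ?_
    · intro k hk
      simp only [mem_filter, Fintype.mem_piFinset, mem_Icc, mem_range] at hk ⊢
      have := hk.1 0
      omega
    · intro i hi
      simp only [mem_filter, Fintype.mem_piFinset, mem_Icc, mem_range, Fin.forall_fin_one,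
        Fin.sum_univ_one, Matrix.cons_val_zero] at hi ⊢
      omega
    · intro k hk
      simp only [mem_filter, Fintype.mem_piFinset, mem_Icc] at hk
      funext j
      fin_cases j
      have := hk.1 0
      simp
      omega
    · simp
    · simp
  rw [h, ← Finset.mul_sum]
  linear_combination mul_neg_geom_sum (1 - p 0) t

theorem probSumLe_two_eq_sum (p : ℕ → ℝ) (t : ℕ) :
    probSumLe p 2 t = ∑ i ∈ range t, p 0 * (1 - p 0) ^ i * (1 - (1 - p 1) ^ (t - 1 - i)) := by
  have h : probSumLe p 2 t = ∑ x ∈ (range t).sigma fun i => range (t - 1 - i),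
      p 0 * (1 - p 0) ^ x.1 * (p 1 * (1 - p 1) ^ x.2) := by
    refine Finset.sum_bij' (fun k _ => ⟨k 0 - 1, k 1 - 1⟩) (fun x _ => ![x.1 + 1, x.2 + 1])
      ?_ ?_ ?_ ?_ ?_
    · intro k hk
      simp only [mem_filter, Fintype.mem_piFinset, mem_Icc, mem_range, mem_sigma,
        Fin.forall_fin_two, Fin.sum_univ_two] at hk ⊢
      omega
    · intro x hx
      simp only [mem_filter, Fintype.mem_piFinset, mem_Icc, mem_range, mem_sigma,
        Fin.forall_fin_two, Fin.sum_univ_two, Matrix.cons_val_zero, Matrix.cons_val_one] at hx ⊢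
      omega
    · intro k hk
      simp only [mem_filter, Fintype.mem_piFinset, mem_Icc, Fin.forall_fin_two] at hk
      funext j
      fin_cases j <;> simp <;> omega
    · simp
    · simp [Fin.prod_univ_two]
  rw [h, Finset.sum_sigma]
  refine Finset.sum_congr rfl fun i _ => ?_
  simp only [← Finset.mul_sum]
  linear_combination (p 0 * (1 - p 0) ^ i) * mul_neg_geom_sum (1 - p 1) (t - 1 - i)

theorem probSumLe_two (p : ℕ → ℝ) (hp : p 0 ≠ p 1) (t : ℕ) :
    probSumLe p 2 t = 1 - (p 0 * (1 - p 1) ^ t - p 1 * (1 - p 0) ^ t) / (p 0 - p 1) := by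
  have hsub : p 0 - p 1 ≠ 0 := sub_ne_zero.mpr hp
  have hgeom₂ := geom_sum₂_mul (1 - p 0) (1 - p 1) t
  have hgeom := mul_neg_geom_sum (1 - p 0) t
  have hsum : probSumLe p 2 t = p 0 * ∑ i ∈ range t, (1 - p 0) ^ i
      - p 0 * ∑ i ∈ range t, (1 - p 0) ^ i * (1 - p 1) ^ (t - 1 - i) := by
    rw [probSumLe_two_eq_sum, Finset.mul_sum, Finset.mul_sum, ← Finset.sum_sub_distrib]
    exact Finset.sum_congr rfl fun i _ => by ring
  rw [hsum]
  field_simp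
  linear_combination (p 0 - p 1) * hgeom + p 0 * hgeom₂

theorem div_sub_pow_one_sub_pos {a b : ℝ} (ha : a < 1) (hb : b < 1) (hne : a ≠ b) {t : ℕ}
    (ht : t ≠ 0) : 0 < ((1 - b) ^ t - (1 - a) ^ t) / (a - b) := by
  rcases hne.lt_or_gt with h | h
  · exact div_pos_of_neg_of_neg
      (sub_neg.mpr (pow_lt_pow_left₀ (by linarith) (by linarith) ht)) (sub_neg.mpr h)
  · exact div_pos (sub_pos.mpr (pow_lt_pow_left₀ (by linarith) (by linarith) ht)) (sub_pos.mpr h)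

/-- weighted adjacent-swap identity: with `a = p_d`,
`b = p_{d+1}`, `w = ω_d`, `v = ω_{d+1}`, where `G_d, G_{d+1}` are independent
geometrics with parameters `a, b` and `G'_d, G'_{d+1}` independent geometrics
with parameters `b, a`, for every `t ∈ ℕ`:
`v·Pr(G'_d ≤ t) + w·Pr(G'_d + G'_{d+1} ≤ t) − w·Pr(G_d ≤ t) − v·Pr(G_d + G_{d+1} ≤ t)
  = (v·b − w·a)·((1−b)^t − (1−a)^t)/(a − b)`,
and this quantity is strictly positive for `t ≥ 1` whenever `w·a < v·b`. -/
theorem stmt11 (a b w v : ℝ) (ha : 0 < a) (ha' : a < 1) (hb : 0 < b)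
    (hb' : b < 1) (hne : a ≠ b) (t : ℕ) :
    (v * probSumLe (fun _ => b) 1 t
        + w * probSumLe (fun i => if i = 0 then b else a) 2 t
        - w * probSumLe (fun _ => a) 1 t
        - v * probSumLe (fun i => if i = 0 then a else b) 2 t
      = (v * b - w * a) * ((1 - b) ^ t - (1 - a) ^ t) / (a - b))
    ∧ (w * a < v * b → 1 ≤ t →
        0 < v * probSumLe (fun _ => b) 1 t
          + w * probSumLe (fun i => if i = 0 then b else a) 2 t
          - w * probSumLe (fun _ => a) 1 t
          - v * probSumLe (fun i => if i = 0 then a else b) 2 t) := by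
  have key : v * probSumLe (fun _ => b) 1 t
        + w * probSumLe (fun i => if i = 0 then b else a) 2 t
        - w * probSumLe (fun _ => a) 1 t
        - v * probSumLe (fun i => if i = 0 then a else b) 2 t
      = (v * b - w * a) * ((1 - b) ^ t - (1 - a) ^ t) / (a - b) := by
    have hab : a - b ≠ 0 := sub_ne_zero.mpr hne
    rw [probSumLe_one, probSumLe_one, probSumLe_two _ (by simpa using hne.symm),
      probSumLe_two _ (by simpa using hne)]
    simp only [if_true, one_ne_zero, if_false]
    rw [← neg_sub a b, div_neg]
    field_simp
    ring
  refine ⟨key, fun hlt ht => ?_⟩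
  rw [key, mul_div_assoc]
  exact mul_pos (sub_pos.mpr hlt)
    (div_sub_pow_one_sub_pos ha' hb' hne (Nat.one_le_iff_ne_zero.mp ht))
end

section
/- Let N, M ∈ ℕ with 1 ≤ N ≤ M and let p_{mi} ∈ [0,1] for m ∈ {1,…,N}, i ∈ {1,…,M}. For a tuple (j₁, …, j_N) ∈ {1,…,M}^N define f(j₁,…,j_N) = Σ_{i=1}^{M} (1 − Π_{m : j_m = i} (1 − p_{mi})), where the empty product equals 1. For each m ∈ {1,…,N} let S_m ⊆ {1,…,M} be a set with |S_m| = N such that p_{mj} ≥ p_{mj′} for every j ∈ S_m and j′ ∉ S_m. Then max over tuples with j_m ∈ S_m for all m of f(j₁,…,j_N) equals max over all tuples (j′₁,…,j′_N) ∈ {1,…,M}^N of f(j′₁,…,j′_N). -/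
open Finset

/-- The expected number of distinct packets delivered in a single time-slot when
access point `m` transmits packet `j m` and transmission of packet `i` by
access point `m` succeeds independently with probability `p m i`: packet `i` is
delivered unless all access points transmitting it fail. -/
noncomputable def expectedDeliveries (N M : ℕ) (p : Fin N → Fin M → ℝ)
    (j : Fin N → Fin M) : ℝ :=
  ∑ i : Fin M, (1 - ∏ m ∈ Finset.univ.filter (fun m : Fin N => j m = i), (1 - p m i))

/-- The probability that packet `i` is not delivered by any access point other than `a`. -/
noncomputable def missProbExcept {N M : ℕ} (p : Fin N → Fin M → ℝ) (j : Fin N → Fin M)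
    (a : Fin N) (i : Fin M) : ℝ :=
  ∏ m ∈ Finset.univ.erase a, if j m = i then 1 - p m i else 1

theorem missProbExcept_le_one {N M : ℕ} {p : Fin N → Fin M → ℝ} (hp0 : ∀ m i, 0 ≤ p m i)
    (hp1 : ∀ m i, p m i ≤ 1) (j : Fin N → Fin M) (a : Fin N) (i : Fin M) :
    missProbExcept p j a i ≤ 1 := by
  refine Finset.prod_le_one (fun m _ => ?_) (fun m _ => ?_)
  · split_ifs <;> linarith [hp1 m i]
  · split_ifs <;> linarith [hp0 m i]

theorem missProbExcept_eq_one {N M : ℕ} (p : Fin N → Fin M → ℝ) {j : Fin N → Fin M}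
    {a : Fin N} {i : Fin M} (h : ∀ m, m ≠ a → j m ≠ i) : missProbExcept p j a i = 1 :=
  Finset.prod_eq_one fun m hm => if_neg (h m (Finset.ne_of_mem_erase hm))

theorem missProbExcept_update {N M : ℕ} (p : Fin N → Fin M → ℝ) (j : Fin N → Fin M)
    (a : Fin N) (v : Fin M) :
    missProbExcept p (Function.update j a v) a = missProbExcept p j a := by
  funext i
  refine Finset.prod_congr rfl fun m hm => ?_
  rw [Function.update_of_ne (Finset.ne_of_mem_erase hm)]

theorem expectedDeliveries_eq_add {N M : ℕ} (p : Fin N → Fin M → ℝ) (j : Fin N → Fin M)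
    (a : Fin N) :
    expectedDeliveries N M p j =
      ∑ i, (1 - missProbExcept p j a i) + p a (j a) * missProbExcept p j a (j a) := by
  have h : ∀ i, 1 - ∏ m ∈ Finset.univ.filter (fun m : Fin N => j m = i), (1 - p m i) =
      (1 - missProbExcept p j a i) +
        if j a = i then p a i * missProbExcept p j a i else 0 := by
    intro i
    rw [Finset.prod_filter, ← Finset.mul_prod_erase Finset.univ _ (Finset.mem_univ a)]
    change 1 - _ * missProbExcept p j a i = _
    split_ifs <;> ring
  simp only [expectedDeliveries, h, Finset.sum_add_distrib]
  simp

/-- Moving access point `a` to a packet nobody else transmits, with at least the same success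
probability, does not decrease the expected number of deliveries. -/
theorem expectedDeliveries_le_update {N M : ℕ} {p : Fin N → Fin M → ℝ}
    (hp0 : ∀ m i, 0 ≤ p m i) (hp1 : ∀ m i, p m i ≤ 1) {j : Fin N → Fin M} {a : Fin N}
    {v : Fin M} (hfree : ∀ m, m ≠ a → j m ≠ v) (hv : p a (j a) ≤ p a v) :
    expectedDeliveries N M p j ≤ expectedDeliveries N M p (Function.update j a v) := by
  rw [expectedDeliveries_eq_add p j a, expectedDeliveries_eq_add p (Function.update j a v) a,
    missProbExcept_update, Function.update_self, missProbExcept_eq_one p hfree]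
  have := mul_le_mul_of_nonneg_left (missProbExcept_le_one hp0 hp1 j a (j a)) (hp0 a (j a))
  linarith

theorem exists_mem_forall_ne {N M : ℕ} (j : Fin N → Fin M) (a : Fin N) {s : Finset (Fin M)}
    (hs : s.card = N) : ∃ v ∈ s, ∀ m, m ≠ a → j m ≠ v := by
  have hlt : ((Finset.univ.erase a).image j).card < s.card := by
    refine Finset.card_image_le.trans_lt ?_
    rw [hs]
    simpa using Finset.card_erase_lt_of_mem (Finset.mem_univ a)
  obtain ⟨v, hv, hvj⟩ := Finset.exists_mem_notMem_of_card_lt_card hlt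
  exact ⟨v, hv, fun m hm h =>
    hvj (Finset.mem_image.2 ⟨m, Finset.mem_erase.2 ⟨hm, Finset.mem_univ m⟩, h⟩)⟩

/-- Every tuple is dominated by one whose entries at the access points in `t` lie in the
sets `S m`. -/
theorem exists_expectedDeliveries_le {N M : ℕ} {p : Fin N → Fin M → ℝ}
    (hp0 : ∀ m i, 0 ≤ p m i) (hp1 : ∀ m i, p m i ≤ 1) {S : Fin N → Finset (Fin M)}
    (hcard : ∀ m, (S m).card = N) (htop : ∀ m, ∀ j ∈ S m, ∀ j' ∉ S m, p m j' ≤ p m j)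
    (j : Fin N → Fin M) (t : Finset (Fin N)) :
    ∃ k : Fin N → Fin M, (∀ m ∈ t, k m ∈ S m) ∧
      expectedDeliveries N M p j ≤ expectedDeliveries N M p k := by
  induction t using Finset.induction_on with
  | empty => exact ⟨j, by simp, le_rfl⟩
  | insert a t _ ih =>
    obtain ⟨k, hk, hjk⟩ := ih
    by_cases hka : k a ∈ S a
    · exact ⟨k, Finset.forall_mem_insert _ _ _ |>.2 ⟨hka, hk⟩, hjk⟩
    · obtain ⟨v, hv, hfree⟩ := exists_mem_forall_ne k a (hcard a)
      refine ⟨Function.update k a v, fun m hm => ?_,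
        hjk.trans (expectedDeliveries_le_update hp0 hp1 hfree (htop a v hv _ hka))⟩
      rcases eq_or_ne m a with rfl | hma
      · simpa using hv
      · rw [Function.update_of_ne hma]
        exact hk m (Finset.mem_of_mem_insert_of_ne hm hma)

/-- if for each access point `m`, `S m` is a set of `N` packets
with the largest success probabilities on `m`, then the maximum of the expected
one-slot delivery count over tuples with `j m ∈ S m` for all `m` equals the
maximum over all tuples. -/
theorem stmt16 (N M : ℕ) (hN : 1 ≤ N) (hNM : N ≤ M)
    (p : Fin N → Fin M → ℝ) (hp0 : ∀ m i, 0 ≤ p m i) (hp1 : ∀ m i, p m i ≤ 1)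
    (S : Fin N → Finset (Fin M)) (hcard : ∀ m, (S m).card = N)
    (htop : ∀ m, ∀ j ∈ S m, ∀ j' ∉ S m, p m j' ≤ p m j) :
    sSup {y : ℝ | ∃ j : Fin N → Fin M,
        (∀ m, j m ∈ S m) ∧ expectedDeliveries N M p j = y} =
      sSup {y : ℝ | ∃ j : Fin N → Fin M, expectedDeliveries N M p j = y} := by
  have hbdd : BddAbove {y : ℝ | ∃ j : Fin N → Fin M, expectedDeliveries N M p j = y} :=
    (Set.finite_range (expectedDeliveries N M p)).bddAbove
  have hsub : {y : ℝ | ∃ j : Fin N → Fin M,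
      (∀ m, j m ∈ S m) ∧ expectedDeliveries N M p j = y} ⊆
      {y : ℝ | ∃ j : Fin N → Fin M, expectedDeliveries N M p j = y} :=
    fun y ⟨j, _, hj⟩ => ⟨j, hj⟩
  have hdom (j : Fin N → Fin M) : ∃ k : Fin N → Fin M, (∀ m, k m ∈ S m) ∧
      expectedDeliveries N M p j ≤ expectedDeliveries N M p k := by
    simpa using exists_expectedDeliveries_le hp0 hp1 hcard htop j Finset.univ
  let j₀ : Fin N → Fin M := fun _ => ⟨0, by omega⟩
  obtain ⟨k₀, hk₀, _⟩ := hdom j₀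
  refine le_antisymm (csSup_le_csSup hbdd ⟨_, k₀, hk₀, rfl⟩ hsub) (csSup_le ⟨_, j₀, rfl⟩ ?_)
  rintro _ ⟨j, rfl⟩
  obtain ⟨k, hk, hjk⟩ := hdom j
  exact hjk.trans (le_csSup (hbdd.mono hsub) ⟨k, hk, rfl⟩)
end
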